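/- Let f : G → G be a graph map, z ∈ G such that ω_f(z) is a solenoid, and let x, y ∈ ω_f(z) be distinct. Then the following are equivalent: (1) x and y are non-separable; (2) there exists a sequence (J_n) of periodic subgraphs with periods (m_n) such that J_{n+1} ⊆ J_n, m_n → ∞, and x, y ∈ J_n for all n; (3) x and y lie in the same connected component of P(z), the intersection of all cycles of graphs containing ω_f(z). -/

import Mathlib

open Set Filter Topology

/-- An arc in `X` with endpoints `a` and `b`: the image of a continuous injection
of `[0,1]` sending `0` to `a` and `1` to `b`. -/
def IsArcWithEnds {X : Type*} [TopologicalSpace X] (A : Set X) (a b : X) : Prop :=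
  ∃ φ : Set.Icc (0:ℝ) 1 → X, Continuous φ ∧ Function.Injective φ ∧
    Set.range φ = A ∧ φ ⟨0, by norm_num⟩ = a ∧ φ ⟨1, by norm_num⟩ = b

/-- A topological graph: a compact connected (metrizable) space which is a union of
finitely many arcs, any two of which are either disjoint or intersect in exactly one
common endpoint. -/
def IsTopGraph (X : Type*) [TopologicalSpace X] : Prop :=
  CompactSpace X ∧ ConnectedSpace X ∧
  ∃ (n : ℕ) (A : Fin n → Set X) (a b : Fin n → X),
    (∀ i, IsArcWithEnds (A i) (a i) (b i)) ∧
    (⋃ i, A i) = Set.univ ∧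
    ∀ i j, i ≠ j →
      A i ∩ A j = ∅ ∨
      ∃ p, A i ∩ A j = {p} ∧ p ∈ ({a i, b i} : Set X) ∧ p ∈ ({a j, b j} : Set X)

/-- A subgraph of `G`: a closed connected subset which is itself a topological graph. -/
def IsSubgraph {G : Type*} [TopologicalSpace G] (K : Set G) : Prop :=
  IsClosed K ∧ IsConnected K ∧ IsTopGraph ↥K

/-- A periodic subgraph with period `k`: `K, f(K), …, f^{k−1}(K)` are pairwise disjoint
and `f^k(K) = K`. -/
def IsPeriodicSubgraph {G : Type*} [TopologicalSpace G] (f : G → G) (K : Set G) (k : ℕ) :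
    Prop :=
  IsSubgraph K ∧ 0 < k ∧ f^[k] '' K = K ∧
    ∀ i j, i < k → j < k → i ≠ j → Disjoint (f^[i] '' K) (f^[j] '' K)

/-- A cycle of graphs with period `k`: the orbit `⋃_{i<k} f^i(K)` of a periodic
subgraph `K` with period `k`. -/
def IsCycleOfGraphs {G : Type*} [TopologicalSpace G] (f : G → G) (X : Set G) (k : ℕ) :
    Prop :=
  ∃ K, IsPeriodicSubgraph f K k ∧ X = ⋃ i ∈ Finset.range k, f^[i] '' K

/-- The ω-limit set of `x` under `f`. -/
def omegaSet {G : Type*} [TopologicalSpace G] (f : G → G) (x : G) : Set G :=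
  ⋂ n : ℕ, closure ((fun m => f^[m] x) '' Set.Ici n)

/-- `ω(f) = ⋃_{x} ω_f(x)`. -/
def omegaUnion {G : Type*} [TopologicalSpace G] (f : G → G) : Set G :=
  ⋃ x, omegaSet f x

/-- A set `W` is a solenoid for `f` if it is infinite and is contained in cycles of
graphs of arbitrarily large periods. -/
def IsSolenoid {G : Type*} [TopologicalSpace G] (f : G → G) (W : Set G) : Prop :=
  W.Infinite ∧ ∀ n : ℕ, ∃ X k, n ≤ k ∧ IsCycleOfGraphs f X k ∧ W ⊆ X

/-- Two points are separable if they belong to two disjoint periodic subgraphs. -/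
def SeparablePoints {G : Type*} [TopologicalSpace G] (f : G → G) (x y : G) : Prop :=
  ∃ I J kI kJ, IsPeriodicSubgraph f I kI ∧ IsPeriodicSubgraph f J kJ ∧
    Disjoint I J ∧ x ∈ I ∧ y ∈ J

/-- An NS-pair: a pair of distinct points of `ω(f)` contained in a nested sequence of
periodic subgraphs whose periods tend to infinity. -/
def IsNSPair {G : Type*} [TopologicalSpace G] (f : G → G) (x y : G) : Prop :=
  x ≠ y ∧ x ∈ omegaUnion f ∧ y ∈ omegaUnion f ∧
  ∃ (J : ℕ → Set G) (m : ℕ → ℕ),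
    (∀ n, IsPeriodicSubgraph f (J n) (m n)) ∧
    (∀ n, J (n + 1) ⊆ J n) ∧
    Filter.Tendsto m Filter.atTop Filter.atTop ∧
    ∀ n, x ∈ J n ∧ y ∈ J n

/-- The pair `⟨x,y⟩` is proximal. -/
def Proximal {G : Type*} [PseudoMetricSpace G] (f : G → G) (x y : G) : Prop :=
  ∀ ε > (0 : ℝ), ∀ N : ℕ, ∃ n ≥ N, dist (f^[n] x) (f^[n] y) < ε

/-- The pair `⟨x,y⟩` is asymptotic. -/
def Asymptotic {G : Type*} [PseudoMetricSpace G] (f : G → G) (x y : G) : Prop :=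
  Filter.Tendsto (fun n => dist (f^[n] x) (f^[n] y)) Filter.atTop (nhds 0)

/-- A scrambled pair is proximal but not asymptotic. -/
def ScrambledPair {G : Type*} [PseudoMetricSpace G] (f : G → G) (x y : G) : Prop :=
  Proximal f x y ∧ ¬ Asymptotic f x y

/-- Li–Yorke chaos: existence of an uncountable scrambled set. -/
def LiYorkeChaotic {G : Type*} [PseudoMetricSpace G] (f : G → G) : Prop :=
  ∃ S : Set G, ¬ S.Countable ∧ ∀ x ∈ S, ∀ y ∈ S, x ≠ y → ScrambledPair f x y

/-- `I ⊆ ℕ` is an independence set for the pair of sets `{A, B}`. -/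
def IsIndepSet {G : Type*} (f : G → G) (A B : Set G) (I : Set ℕ) : Prop :=
  ∀ J : Finset ℕ, ↑J ⊆ I → J.Nonempty → ∀ S : ℕ → Bool,
    (⋂ i ∈ J, f^[i] ⁻¹' (if S i then A else B)).Nonempty

/-- An IN-pair: every pair of neighborhoods has arbitrarily large finite
independence sets. -/
def IsINPair {G : Type*} [TopologicalSpace G] (f : G → G) (x y : G) : Prop :=
  ∀ U V : Set G, U ∈ nhds x → V ∈ nhds y →
    ∀ n : ℕ, ∃ I : Finset ℕ, n ≤ I.card ∧ IsIndepSet f U V ↑I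

/-- An IT-pair: every pair of neighborhoods has an infinite independence set. -/
def IsITPair {G : Type*} [TopologicalSpace G] (f : G → G) (x y : G) : Prop :=
  ∀ U V : Set G, U ∈ nhds x → V ∈ nhds y →
    ∃ I : Set ℕ, I.Infinite ∧ IsIndepSet f U V I

/-- The set of periodic points of `f`. -/
def PerPts {G : Type*} (f : G → G) : Set G :=
  {p | ∃ n ≥ 1, f^[n] p = p}

/-- `K` is the union of the arcs `ψ i '' [l i, r i]`, any two of which meet in at most one point,
which is then a common endpoint. -/
structure IsEdgeFamily {X ι : Type*} [TopologicalSpace X] (K : Set X) (ψ : ι → ℝ → X)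
    (l r : ι → ℝ) : Prop where
  continuous : ∀ i, Continuous (ψ i)
  lt : ∀ i, l i < r i
  injOn : ∀ i, InjOn (ψ i) (Icc (l i) (r i))
  cover : ⋃ i, ψ i '' Icc (l i) (r i) = K
  endpoint : ∀ i j, i ≠ j → ∀ s ∈ Icc (l i) (r i), ∀ t ∈ Icc (l j) (r j), ψ i s = ψ j t →
    s = l i ∨ s = r i
  subsingleton : ∀ i j, i ≠ j →
    (ψ i '' Icc (l i) (r i) ∩ ψ j '' Icc (l j) (r j)).Subsingleton

theorem IsTopGraph.exists_isEdgeFamily {X : Type*} [TopologicalSpace X] (h : IsTopGraph X) :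
    ∃ (n : ℕ) (ψ : Fin n → ℝ → X), IsEdgeFamily univ ψ (fun _ => 0) (fun _ => 1) := by
  obtain ⟨-, -, n, A, a, b, harc, hcov, hint⟩ := h
  choose φ hc hi hr h0 h1 using harc
  have him : ∀ i, (fun t => φ i (projIcc 0 1 zero_le_one t)) '' Icc (0 : ℝ) 1 = A i := by
    intro i
    rw [← hr i]
    ext p
    constructor
    · rintro ⟨t, -, rfl⟩
      exact mem_range_self _
    · rintro ⟨t, rfl⟩
      exact ⟨t, t.2, by simp⟩
  refine ⟨n, fun i t => φ i (projIcc 0 1 zero_le_one t),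
    fun i => (hc i).comp continuous_projIcc, fun _ => zero_lt_one, ?_, ?_, ?_, ?_⟩
  · intro i s hs t ht hst
    have := hi i hst
    rw [projIcc_of_mem _ hs, projIcc_of_mem _ ht] at this
    exact congrArg Subtype.val this
  · simp only [him, hcov]
  · intro i j hij s hs t ht hst
    have hmem : φ i ⟨s, hs⟩ ∈ A i ∩ A j := by
      refine ⟨hr i ▸ mem_range_self _, ?_⟩
      rw [← hr j]
      refine ⟨⟨t, ht⟩, ?_⟩
      simpa [projIcc_of_mem, hs, ht] using hst.symm
    rcases hint i j hij with he | ⟨p, hp, hpi, -⟩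
    · rw [he] at hmem
      exact hmem.elim
    · rw [hp, mem_singleton_iff] at hmem
      rw [← hmem] at hpi
      rcases hpi with hpi | hpi
      · left
        exact congrArg Subtype.val (hi i (hpi.trans (h0 i).symm))
      · right
        exact congrArg Subtype.val (hi i ((mem_singleton_iff.1 hpi).trans (h1 i).symm))
  · intro i j hij
    simp only [him]
    rcases hint i j hij with he | ⟨p, hp, -, -⟩
    · rw [he]
      exact subsingleton_empty
    · rw [hp]
      exact subsingleton_singleton

theorem IsEdgeFamily.isTopGraph {X ι : Type*} [TopologicalSpace X] [Finite ι] {K : Set X}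
    {ψ : ι → ℝ → X} {l r : ι → ℝ} (h : IsEdgeFamily K ψ l r) (hK : IsCompact K)
    (hconn : IsConnected K) : IsTopGraph K := by
  have hmem : ∀ i, ∀ t ∈ Icc (l i) (r i), ψ i t ∈ K := fun i t ht =>
    h.cover ▸ mem_iUnion.2 ⟨i, t, ht, rfl⟩
  have haff : ∀ i, ∀ t ∈ Icc (0 : ℝ) 1, l i + t * (r i - l i) ∈ Icc (l i) (r i) := by
    intro i t ht
    have := h.lt i
    constructor <;> nlinarith [ht.1, ht.2]
  obtain ⟨n, ⟨e⟩⟩ := Finite.exists_equiv_fin ι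
  let φ : ∀ i, Icc (0 : ℝ) 1 → K := fun i t =>
    ⟨ψ i (l i + t * (r i - l i)), hmem i _ (haff i t t.2)⟩
  have hrange : ∀ i (p : K), p ∈ range (φ i) ↔ (p : X) ∈ ψ i '' Icc (l i) (r i) := by
    intro i p
    have hlt := h.lt i
    constructor
    · rintro ⟨t, rfl⟩
      exact ⟨_, haff i t t.2, rfl⟩
    · rintro ⟨s, hs, hsp⟩
      have hpos : 0 < r i - l i := sub_pos.2 hlt
      refine ⟨⟨(s - l i) / (r i - l i), div_nonneg (sub_nonneg.2 hs.1) hpos.le,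
        (div_le_one hpos).2 (by linarith [hs.2])⟩, Subtype.ext ?_⟩
      rw [← hsp]
      change ψ i (l i + (s - l i) / (r i - l i) * (r i - l i)) = ψ i s
      rw [div_mul_cancel₀ _ hpos.ne', add_sub_cancel]
  have hend : ∀ i j, i ≠ j → ∀ p : K, p ∈ range (φ i) → p ∈ range (φ j) →
      p ∈ ({φ i ⟨0, by norm_num⟩, φ i ⟨1, by norm_num⟩} : Set K) := by
    intro i j hij p hi hj
    obtain ⟨s, hs, hsp⟩ := (hrange i p).1 hi
    obtain ⟨t, ht, htp⟩ := (hrange j p).1 hj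
    rcases h.endpoint i j hij s hs t ht (hsp.trans htp.symm) with rfl | rfl
    · left
      exact Subtype.ext (by simp [φ, hsp])
    · right
      exact Subtype.ext (by simp [φ, hsp])
  refine ⟨isCompact_iff_compactSpace.1 hK, isConnected_iff_connectedSpace.1 hconn, n,
    fun i => range (φ (e.symm i)), fun i => φ (e.symm i) ⟨0, by norm_num⟩,
    fun i => φ (e.symm i) ⟨1, by norm_num⟩, fun i => ⟨φ (e.symm i), ?_, ?_, rfl, rfl, rfl⟩, ?_, ?_⟩
  · exact ((h.continuous _).comp (by fun_prop)).subtype_mk _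
  · intro s t hst
    have := h.injOn _ (haff _ s s.2) (haff _ t t.2) (congrArg Subtype.val hst)
    have hpos := sub_pos.2 (h.lt (e.symm i))
    exact Subtype.ext (mul_right_cancel₀ hpos.ne' (add_left_cancel this))
  · refine eq_univ_of_forall fun p => ?_
    have hp : (p : X) ∈ ⋃ i, ψ i '' Icc (l i) (r i) := h.cover ▸ p.2
    obtain ⟨i, hi⟩ := mem_iUnion.1 hp
    exact mem_iUnion.2 ⟨e i, by rw [e.symm_apply_apply]; exact (hrange i p).2 hi⟩
  · intro i j hij
    have hij' : e.symm i ≠ e.symm j := fun heq => hij (e.symm.injective heq)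
    rcases (range (φ (e.symm i)) ∩ range (φ (e.symm j))).eq_empty_or_nonempty with he | ⟨p, hp⟩
    · exact Or.inl he
    · refine Or.inr ⟨p, ?_, hend _ _ hij' p hp.1 hp.2, hend _ _ hij'.symm p hp.2 hp.1⟩
      refine eq_singleton_iff_unique_mem.2 ⟨hp, fun q hq => Subtype.ext ?_⟩
      exact h.subsingleton _ _ hij' ⟨(hrange _ q).1 hq.1, (hrange _ q).1 hq.2⟩
        ⟨(hrange _ p).1 hp.1, (hrange _ p).1 hp.2⟩

theorem exists_eq_Icc_of_isCompact_isPreconnected {S : Set ℝ} (hc : IsCompact S)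
    (hp : IsPreconnected S) : ∃ a b, S = Icc a b := by
  rcases S.eq_empty_or_nonempty with rfl | hne
  · exact ⟨1, 0, by simp⟩
  · exact ⟨_, _, eq_Icc_of_connected_compact ⟨hne, hp⟩ hc⟩

theorem IsClosed.isClosed_connectedComponentIn {X : Type*} [TopologicalSpace X] {F : Set X}
    (hF : IsClosed F) (x : X) : IsClosed (connectedComponentIn F x) := by
  by_cases hx : x ∈ F
  · refine closure_subset_iff_isClosed.1 ?_
    exact isPreconnected_connectedComponentIn.closure.subset_connectedComponentIn
      (subset_closure (mem_connectedComponentIn hx))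
      (closure_minimal (connectedComponentIn_subset F x) hF)
  · rw [connectedComponentIn_eq_empty hx]
    exact isClosed_empty

section Edges

variable {X ι : Type*} [TopologicalSpace X] [T2Space X] [Finite ι] {ψ : ι → ℝ → X}

theorem IsEdgeFamily.isOpen_image_Ioo (h : IsEdgeFamily univ ψ (fun _ => 0) (fun _ => 1)) (i : ι)
    {s t : ℝ} (hs : 0 ≤ s) (ht : t ≤ 1) : IsOpen (ψ i '' Ioo s t) := by
  have hclosed : IsClosed ((⋃ j ∈ {j | j ≠ i}, ψ j '' Icc 0 1) ∪
      ψ i '' (Icc 0 1 \ Ioo s t)) := by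
    refine IsClosed.union ?_ ?_
    · exact (toFinite _).isClosed_biUnion fun j _ =>
        (isCompact_Icc.image (h.continuous j)).isClosed
    · exact ((isCompact_Icc.diff isOpen_Ioo).image (h.continuous i)).isClosed
  convert hclosed.isOpen_compl using 1
  ext p
  simp only [mem_compl_iff, mem_union, not_or]
  constructor
  · rintro ⟨u, hu, rfl⟩
    have hu' : u ∈ Icc (0 : ℝ) 1 := ⟨hs.trans hu.1.le, hu.2.le.trans ht⟩
    constructor
    · simp only [mem_iUnion, not_exists]
      rintro j hj ⟨v, hv, hvu⟩
      rcases h.endpoint i j (Ne.symm hj) u hu' v hv hvu.symm with rfl | rfl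
      · linarith [hu.1]
      · linarith [hu.2]
    · rintro ⟨v, hv, hvu⟩
      rw [h.injOn i hv.1 hu' hvu] at hv
      exact hv.2 hu
  · rintro ⟨h1, h2⟩
    obtain ⟨j, u, hu, rfl⟩ := mem_iUnion.1 (h.cover.symm ▸ mem_univ p)
    by_cases hj : j = i
    · subst hj
      by_contra hcon
      exact h2 ⟨u, ⟨hu, fun hu' => hcon ⟨u, hu', rfl⟩⟩, rfl⟩
    · exact (h1 (mem_biUnion (x := j) hj ⟨u, hu, rfl⟩)).elim

/-- The trace of a subcontinuum on an edge is a disjoint union of at most two closed intervals. -/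
theorem IsEdgeFamily.exists_trace_eq (h : IsEdgeFamily univ ψ (fun _ => 0) (fun _ => 1))
    {K : Set X} (hK : IsClosed K) (hconn : IsPreconnected K) (i : ι) :
    ∃ a b : Bool → ℝ, Icc 0 1 ∩ ψ i ⁻¹' K = ⋃ c, Icc (a c) (b c) ∧
      ∀ c d, c ≠ d → Disjoint (Icc (a c) (b c)) (Icc (a d) (b d)) := by
  set C := Icc 0 1 ∩ ψ i ⁻¹' K
  have hCc : IsCompact C := isCompact_Icc.inter_right (hK.preimage (h.continuous i))
  suffices H : ∃ U V : Set ℝ, C = U ∪ V ∧ IsCompact U ∧ IsPreconnected U ∧ IsCompact V ∧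
      IsPreconnected V ∧ Disjoint U V by
    obtain ⟨U, V, hUV, hU, hU', hV, hV', hd⟩ := H
    obtain ⟨a, b, rfl⟩ := exists_eq_Icc_of_isCompact_isPreconnected hU hU'
    obtain ⟨c, d, rfl⟩ := exists_eq_Icc_of_isCompact_isPreconnected hV hV'
    refine ⟨fun k => bif k then a else c, fun k => bif k then b else d, ?_, ?_⟩
    · rw [hUV, ← union_eq_iUnion.symm]
      ext t
      simp [or_comm]
    · rintro (_ | _) (_ | _) hne
      · exact (hne rfl).elim
      · exact hd.symm
      · exact hd
      · exact (hne rfl).elim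
  have himg : ∀ {S : Set ℝ}, IsCompact S → IsClosed (ψ i '' S) := fun hS =>
    (hS.image (h.continuous i)).isClosed
  by_cases hin : K ⊆ ψ i '' Ioo 0 1
  · refine ⟨C, ∅, by simp, hCc, ?_, isCompact_empty, isPreconnected_empty, disjoint_empty C⟩
    refine OrdConnected.isPreconnected ⟨fun u hu w hw v hv => ?_⟩
    have hv01 : v ∈ Icc (0 : ℝ) 1 := ⟨hu.1.1.trans hv.1, hv.2.trans hw.1.2⟩
    refine ⟨hv01, ?_⟩
    by_contra hvK
    have key := (isPreconnected_iff_subset_of_disjoint_closed.1 hconn)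
      (ψ i '' Icc 0 v) (ψ i '' Icc v 1) (himg isCompact_Icc) (himg isCompact_Icc) (by
        intro p hp
        obtain ⟨t, ht, rfl⟩ := hin hp
        rcases le_total t v with htv | htv
        · exact Or.inl ⟨t, ⟨ht.1.le, htv⟩, rfl⟩
        · exact Or.inr ⟨t, ⟨htv, ht.2.le⟩, rfl⟩) (by
        refine eq_empty_iff_forall_notMem.2 ?_
        rintro p ⟨hpK, ⟨s, hs, rfl⟩, ⟨t, ht, hst⟩⟩
        have := h.injOn i (x₁ := t) ⟨hv01.1.trans ht.1, ht.2⟩ ⟨hs.1, hs.2.trans hv01.2⟩ hst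
        have hsv : s = v := le_antisymm hs.2 (this ▸ ht.1)
        exact hvK (hsv ▸ hpK))
    rcases key with hk | hk
    · obtain ⟨t, ht, htw⟩ := hk hw.2
      have := h.injOn i (x₁ := t) ⟨ht.1, ht.2.trans hv01.2⟩ hw.1 htw
      have : w = v := le_antisymm (this ▸ ht.2) hv.2
      exact hvK (this ▸ hw.2)
    · obtain ⟨t, ht, htu⟩ := hk hu.2
      have := h.injOn i (x₁ := t) ⟨hv01.1.trans ht.1, ht.2⟩ hu.1 htu
      have : u = v := le_antisymm hv.1 (this ▸ ht.1)
      exact hvK (this ▸ hu.2)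
  have hcompact : ∀ x, IsCompact (connectedComponentIn C x) := fun x =>
    hCc.of_isClosed_subset (hCc.isClosed.isClosed_connectedComponentIn x)
      (connectedComponentIn_subset C x)
  have hunion : C = connectedComponentIn C 0 ∪ connectedComponentIn C 1 := by
    refine Subset.antisymm (fun c hc => ?_)
      (union_subset (connectedComponentIn_subset C 0) (connectedComponentIn_subset C 1))
    by_cases h0 : Icc 0 c ⊆ C
    · exact Or.inl (isPreconnected_Icc.subset_connectedComponentIn (left_mem_Icc.2 hc.1.1) h0
        (right_mem_Icc.2 hc.1.1))
    by_cases h1 : Icc c 1 ⊆ C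
    · exact Or.inr (isPreconnected_Icc.subset_connectedComponentIn (right_mem_Icc.2 hc.1.2) h1
        (left_mem_Icc.2 hc.1.2))
    obtain ⟨s, hs, hsC⟩ := not_subset.1 h0
    obtain ⟨t, ht, htC⟩ := not_subset.1 h1
    have hs01 : s ∈ Icc (0 : ℝ) 1 := ⟨hs.1, hs.2.trans hc.1.2⟩
    have ht01 : t ∈ Icc (0 : ℝ) 1 := ⟨hc.1.1.trans ht.1, ht.2⟩
    have hsc : s < c := lt_of_le_of_ne hs.2 fun he => hsC (he ▸ hc)
    have hct : c < t := lt_of_le_of_ne ht.1 fun he => htC (he ▸ hc)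
    have hopen := h.isOpen_image_Ioo i hs01.1 ht01.2
    exfalso
    refine hin (Subset.trans ?_ (image_mono (Ioo_subset_Ioo hs01.1 ht01.2)))
    have key := (isPreconnected_iff_subset_of_disjoint_closed.1 hconn)
      (ψ i '' Icc s t) (ψ i '' Ioo s t)ᶜ (himg isCompact_Icc) hopen.isClosed_compl (by
        intro p _
        by_cases hp : p ∈ ψ i '' Ioo s t
        · exact Or.inl (image_mono Ioo_subset_Icc_self hp)
        · exact Or.inr hp) (by
        refine eq_empty_iff_forall_notMem.2 ?_
        rintro p ⟨hpK, ⟨u, hu, rfl⟩, hp⟩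
        rcases hu.1.eq_or_lt with rfl | hsu
        · exact hsC ⟨hs01, hpK⟩
        rcases hu.2.eq_or_lt with rfl | hut
        · exact htC ⟨ht01, hpK⟩
        exact hp ⟨u, ⟨hsu, hut⟩, rfl⟩)
    rcases key with hk | hk
    · intro p hpK
      obtain ⟨u, hu, rfl⟩ := hk hpK
      rcases hu.1.eq_or_lt with rfl | hsu
      · exact (hsC ⟨hs01, hpK⟩).elim
      rcases hu.2.eq_or_lt with rfl | hut
      · exact (htC ⟨ht01, hpK⟩).elim
      exact ⟨u, ⟨hsu, hut⟩, rfl⟩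
    · exact (hk hc.2 ⟨c, ⟨hsc, hct⟩, rfl⟩).elim
  by_cases hdisj : Disjoint (connectedComponentIn C 0) (connectedComponentIn C 1)
  · exact ⟨_, _, hunion, hcompact 0, isPreconnected_connectedComponentIn, hcompact 1,
      isPreconnected_connectedComponentIn, hdisj⟩
  · obtain ⟨p, hp0, hp1⟩ := not_disjoint_iff.1 hdisj
    have heq : connectedComponentIn C 0 = connectedComponentIn C 1 :=
      (connectedComponentIn_eq hp0).trans (connectedComponentIn_eq hp1).symm
    rw [← heq, union_self] at hunion
    exact ⟨_, ∅, by rw [union_empty]; exact hunion, hcompact 0,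
      isPreconnected_connectedComponentIn, isCompact_empty, isPreconnected_empty,
      disjoint_empty _⟩

theorem IsEdgeFamily.finite_frontier (h : IsEdgeFamily univ ψ (fun _ => 0) (fun _ => 1))
    {K : Set X} (hK : IsClosed K) (hconn : IsPreconnected K) : (frontier K).Finite := by
  choose a b hab _ using fun i => h.exists_trace_eq hK hconn i
  refine Finite.subset (s := ⋃ i, ψ i '' (⋃ c, ({0, 1, a i c, b i c} : Set ℝ))) ?_ ?_
  · exact finite_iUnion fun i => (finite_iUnion fun c => toFinite _).image _
  · intro p hp
    obtain ⟨i, t, ht, rfl⟩ := mem_iUnion.1 (h.cover.symm ▸ mem_univ p)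
    have htC : t ∈ Icc 0 1 ∩ ψ i ⁻¹' K := ⟨ht, hK.frontier_subset hp⟩
    rw [hab i] at htC
    obtain ⟨c, hc⟩ := mem_iUnion.1 htC
    refine mem_iUnion.2 ⟨i, t, mem_iUnion.2 ⟨c, ?_⟩, rfl⟩
    by_contra hcon
    simp only [mem_insert_iff, mem_singleton_iff, not_or] at hcon
    obtain ⟨h0, h1, ha, hb⟩ := hcon
    refine hp.2 (mem_interior.2 ⟨ψ i '' Ioo (max 0 (a i c)) (min 1 (b i c)), ?_,
      h.isOpen_image_Ioo i (le_max_left _ _) (min_le_left _ _), t, ⟨?_, ?_⟩, rfl⟩)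
    · rintro _ ⟨u, hu, rfl⟩
      have : u ∈ Icc 0 1 ∩ ψ i ⁻¹' K := by
        rw [hab i]
        exact mem_iUnion.2 ⟨c, (le_max_right _ _).trans hu.1.le, hu.2.le.trans (min_le_right _ _)⟩
      exact this.2
    · exact max_lt (lt_of_le_of_ne ht.1 (Ne.symm h0)) (lt_of_le_of_ne hc.1 (Ne.symm ha))
    · exact lt_min (lt_of_le_of_ne ht.2 h1) (lt_of_le_of_ne hc.2 hb)

end Edges

/-- A nondegenerate subcontinuum of a topological graph is a subgraph. -/
theorem IsTopGraph.isSubgraph_of_nontrivial {X : Type*} [TopologicalSpace X] [T2Space X]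
    (hX : IsTopGraph X) {K : Set X} (hK : IsClosed K) (hconn : IsPreconnected K)
    (hne : K.Nontrivial) : IsSubgraph K := by
  obtain ⟨n, ψ, h⟩ := hX.exists_isEdgeFamily
  have := hX.1
  choose a b hab hdisj using fun i => h.exists_trace_eq hK hconn i
  have htrace : ∀ i c t, t ∈ Icc (a i c) (b i c) → t ∈ Icc 0 1 ∩ ψ i ⁻¹' K := by
    intro i c t ht
    rw [hab i]
    exact mem_iUnion.2 ⟨c, ht⟩
  have hcover : ⋃ q : {q : Fin n × Bool // a q.1 q.2 < b q.1 q.2},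
      ψ q.1.1 '' Icc (a q.1.1 q.1.2) (b q.1.1 q.1.2) = K := by
    set L := ⋃ q : {q : Fin n × Bool // a q.1 q.2 < b q.1 q.2},
      ψ q.1.1 '' Icc (a q.1.1 q.1.2) (b q.1.1 q.1.2)
    have hLK : L ⊆ K := by
      refine iUnion_subset fun q => ?_
      rintro _ ⟨t, ht, rfl⟩
      exact (htrace _ _ t ht).2
    have hLc : IsClosed L := isClosed_iUnion_of_finite fun q =>
      (isCompact_Icc.image (h.continuous _)).isClosed
    have hfin : (K \ L).Finite := by
      refine Finite.subset (s := range fun q : Fin n × Bool => ψ q.1 (a q.1 q.2))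
        (finite_range _) ?_
      rintro p ⟨hpK, hpL⟩
      obtain ⟨i, t, ht, rfl⟩ := mem_iUnion.1 (h.cover.symm ▸ mem_univ p)
      have htC : t ∈ Icc 0 1 ∩ ψ i ⁻¹' K := ⟨ht, hpK⟩
      rw [hab i] at htC
      obtain ⟨c, hc⟩ := mem_iUnion.1 htC
      rcases (hc.1.trans hc.2).eq_or_lt with he | hlt
      · exact ⟨(i, c), congrArg (ψ i) (le_antisymm hc.1 (he ▸ hc.2))⟩
      · exact (hpL (mem_iUnion.2 ⟨⟨(i, c), hlt⟩, t, hc, rfl⟩)).elim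
    rcases (isPreconnected_iff_subset_of_disjoint_closed.1 hconn) L (K \ L) hLc hfin.isClosed
      (by rw [union_sdiff_self]; exact subset_union_right) (by simp) with hk | hk
    · exact Subset.antisymm hLK hk
    · exact (hconn.infinite_of_nontrivial hne (hfin.subset hk)).elim
  refine ⟨hK, ⟨hne.nonempty, hconn⟩, IsEdgeFamily.isTopGraph
    (ψ := fun q : {q : Fin n × Bool // a q.1 q.2 < b q.1 q.2} => ψ q.1.1)
    (l := fun q => a q.1.1 q.1.2) (r := fun q => b q.1.1 q.1.2)
    ⟨fun q => h.continuous _, fun q => q.2, ?_, hcover, ?_, ?_⟩ hK.isCompact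
    ⟨hne.nonempty, hconn⟩⟩
  · exact fun q => (h.injOn _).mono fun t ht => (htrace _ _ t ht).1
  · rintro ⟨⟨i, c⟩, hq⟩ ⟨⟨j, d⟩, hq'⟩ hne s hs t ht hst
    have hs' := htrace i c s hs
    have ht' := htrace j d t ht
    by_cases hij : i = j
    · subst hij
      obtain rfl := h.injOn i hs'.1 ht'.1 hst
      have hcd : c ≠ d := fun hcd => hne (by subst hcd; rfl)
      exact (disjoint_left.1 (hdisj i c d hcd) hs ht).elim
    · rcases h.endpoint i j hij s hs'.1 t ht'.1 hst with rfl | rfl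
      · left
        exact le_antisymm (htrace i c _ (left_mem_Icc.2 hq.le)).1.1 hs.1
      · right
        exact le_antisymm hs.2 (htrace i c _ (right_mem_Icc.2 hq.le)).1.2
  · rintro ⟨⟨i, c⟩, hq⟩ ⟨⟨j, d⟩, hq'⟩ hne
    by_cases hij : i = j
    · subst hij
      rintro p ⟨⟨s, hs, rfl⟩, t, ht, hst⟩
      obtain rfl := h.injOn i (htrace _ _ t ht).1 (htrace _ _ s hs).1 hst
      have hcd : c ≠ d := fun hcd => hne (by subst hcd; rfl)
      exact (disjoint_left.1 (hdisj i c d hcd) hs ht).elim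
    · exact (h.subsingleton i j hij).anti (inter_subset_inter
        (image_mono fun t ht => (htrace i c t ht).1) (image_mono fun t ht => (htrace j d t ht).1))

theorem IsPreconnected.subset_of_disjoint_frontier {X : Type*} [TopologicalSpace X] {K S : Set X}
    (hK : IsPreconnected K) (hS : IsClosed S) (hne : (K ∩ S).Nonempty)
    (hd : Disjoint K (frontier S)) : K ⊆ S := by
  obtain ⟨p, hpK, hpS⟩ := hne
  have hint : ∀ q ∈ K, q ∈ S → q ∈ interior S := fun q hq hqS => by
    by_contra hcon
    exact disjoint_left.1 hd hq ⟨subset_closure hqS, hcon⟩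
  refine (hK.subset_left_of_subset_union isOpen_interior hS.isOpen_compl
    (disjoint_compl_right.mono_left interior_subset) (fun q hq => ?_)
    ⟨p, hpK, hint p hpK hpS⟩).trans interior_subset
  by_cases hqS : q ∈ S
  · exact Or.inl (hint q hq hqS)
  · exact Or.inr hqS

theorem isPreconnected_iInter_of_antitone {X : Type*} [TopologicalSpace X] [T2Space X]
    {J : ℕ → Set X} (hJ : Antitone J) (hc : ∀ n, IsCompact (J n))
    (hp : ∀ n, IsPreconnected (J n)) : IsPreconnected (⋂ n, J n) := by
  have hcl : IsCompact (⋂ n, J n) :=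
    (hc 0).of_isClosed_subset (isClosed_iInter fun n => (hc n).isClosed) (iInter_subset J 0)
  intro u v hu hv huv ⟨p, hp₁, hpu⟩ ⟨q, hq₁, hqv⟩
  by_contra hcon
  have hnot : ∀ r ∈ ⋂ n, J n, r ∈ u → r ∉ v := fun r hr hru hrv => hcon ⟨r, hr, hru, hrv⟩
  have hAc : IsCompact ((⋂ n, J n) \ v) := hcl.diff hv
  have hBc : IsCompact ((⋂ n, J n) \ u) := hcl.diff hu
  obtain ⟨U, V, hU, hV, hAU, hBV, hUV⟩ := SeparatedNhds.of_isCompact_isCompact hAc hBc (by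
    refine disjoint_left.2 fun r hr hr' => ?_
    rcases huv hr.1 with h | h
    · exact hr'.2 h
    · exact hr.2 h)
  obtain ⟨n, hn⟩ := exists_subset_nhds_of_isCompact (U := U ∪ V) hJ.directed_ge hc (fun r hr => by
    refine (hU.union hV).mem_nhds ?_
    by_cases hrv : r ∈ v
    · exact Or.inr (hBV ⟨hr, fun hru => hnot r hr hru hrv⟩)
    · exact Or.inl (hAU ⟨hr, hrv⟩))
  obtain ⟨r, -, hrU, hrV⟩ := hp n U V hU hV hn
    ⟨p, mem_iInter.1 hp₁ n, hAU ⟨hp₁, hnot p hp₁ hpu⟩⟩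
    ⟨q, mem_iInter.1 hq₁ n, hBV ⟨hq₁, fun hqu => hnot q hq₁ hqu hqv⟩⟩
  exact disjoint_left.1 hUV hrU hrV

theorem image_iterate_mod {X : Type*} {f : X → X} {K : Set X} {k : ℕ} (h : f^[k] '' K = K)
    (n : ℕ) : f^[n] '' K = f^[n % k] '' K := by
  have hmul : ∀ q, f^[k * q] '' K = K := by
    intro q
    induction q with
    | zero => simp
    | succ q ih => rw [Nat.mul_succ, Function.iterate_add, image_comp, h, ih]
  conv_lhs => rw [← Nat.mod_add_div n k, Function.iterate_add, image_comp, hmul]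

theorem IsTopGraph.nontrivial {X : Type*} [TopologicalSpace X] (hX : IsTopGraph X) :
    Nontrivial X := by
  obtain ⟨n, ψ, h⟩ := hX.exists_isEdgeFamily
  have := hX.2.1
  obtain ⟨p⟩ := this.toNonempty
  obtain ⟨i, -⟩ := mem_iUnion.1 (h.cover.symm ▸ mem_univ p)
  exact ⟨ψ i 0, ψ i 1, fun he => zero_ne_one (h.injOn i (by simp) (by simp) he)⟩

theorem IsSubgraph.nontrivial {X : Type*} [TopologicalSpace X] {K : Set X} (hK : IsSubgraph K) :
    K.Nontrivial :=
  nontrivial_coe_sort.1 hK.2.2.nontrivial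

section Periodic

variable {G : Type*} [TopologicalSpace G] {f : G → G} {I K : Set G} {k m : ℕ}

theorem IsPeriodicSubgraph.image_subset_orbit (hI : IsPeriodicSubgraph f I k) (n : ℕ) :
    f^[n] '' I ⊆ ⋃ i ∈ Finset.range k, f^[i] '' I := by
  rw [image_iterate_mod hI.2.2.1 n]
  exact subset_biUnion_of_mem (u := fun i => f^[i] '' I)
    (Finset.mem_coe.2 (Finset.mem_range.2 (Nat.mod_lt _ hI.2.1)))

theorem IsPeriodicSubgraph.subset_orbit (hI : IsPeriodicSubgraph f I k) :
    I ⊆ ⋃ i ∈ Finset.range k, f^[i] '' I := by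
  simpa using hI.image_subset_orbit 0

theorem IsPeriodicSubgraph.mapsTo_orbit (hI : IsPeriodicSubgraph f I k) (n : ℕ) :
    MapsTo f^[n] (⋃ i ∈ Finset.range k, f^[i] '' I) (⋃ i ∈ Finset.range k, f^[i] '' I) := by
  intro p hp
  obtain ⟨i, -, q, hq, rfl⟩ := mem_iUnion₂.1 hp
  rw [← Function.iterate_add_apply]
  exact hI.image_subset_orbit _ (mem_image_of_mem _ hq)

theorem IsPeriodicSubgraph.isPreconnected_image (hf : Continuous f)
    (hI : IsPeriodicSubgraph f I k) (n : ℕ) : IsPreconnected (f^[n] '' I) :=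
  hI.1.2.1.isPreconnected.image _ (hf.iterate n).continuousOn

variable [T2Space G]

theorem IsPeriodicSubgraph.isClosed_image (hG : IsTopGraph G) (hf : Continuous f)
    (hI : IsPeriodicSubgraph f I k) (n : ℕ) : IsClosed (f^[n] '' I) :=
  have := hG.1
  (hI.1.1.isCompact.image (hf.iterate n)).isClosed

theorem IsPeriodicSubgraph.isClosed_orbit (hG : IsTopGraph G) (hf : Continuous f)
    (hI : IsPeriodicSubgraph f I k) : IsClosed (⋃ i ∈ Finset.range k, f^[i] '' I) :=
  (Finset.range k).finite_toSet.isClosed_biUnion fun i _ => hI.isClosed_image hG hf i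

/-- The images of a periodic subgraph are periodic subgraphs of the same period. -/
theorem IsPeriodicSubgraph.image (hG : IsTopGraph G) (hf : Continuous f)
    (hI : IsPeriodicSubgraph f I k) {n : ℕ} (hn : n < k) :
    IsPeriodicSubgraph f (f^[n] '' I) k := by
  refine ⟨hG.isSubgraph_of_nontrivial (hI.isClosed_image hG hf n)
    (hI.isPreconnected_image hf n) ?_, hI.2.1, ?_, ?_⟩
  · by_contra hcon
    rw [not_nontrivial_iff] at hcon
    have hsub := hcon.image f^[k - n]
    rw [← image_comp, ← Function.iterate_add, Nat.sub_add_cancel hn.le, hI.2.2.1] at hsub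
    exact not_nontrivial_iff.2 hsub hI.1.nontrivial
  · rw [← image_comp, ← Function.iterate_add, add_comm, Function.iterate_add, image_comp,
      hI.2.2.1]
  · intro i j hi hj hij
    rw [← image_comp, ← image_comp, ← Function.iterate_add, ← Function.iterate_add,
      image_iterate_mod hI.2.2.1 (i + n), image_iterate_mod hI.2.2.1 (j + n)]
    refine hI.2.2.2 _ _ (Nat.mod_lt _ hI.2.1) (Nat.mod_lt _ hI.2.1) fun he => hij ?_
    have hmod : i ≡ j [MOD k] := Nat.ModEq.add_right_cancel' n he
    exact hmod.eq_of_lt_of_lt hi hj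

/-- A connected subset of a cycle of graphs lies in a single component of the cycle. -/
theorem IsPeriodicSubgraph.subset_image_of_subset_orbit (hG : IsTopGraph G) (hf : Continuous f)
    (hI : IsPeriodicSubgraph f I k) {C : Set G} (hC : IsPreconnected C)
    (hsub : C ⊆ ⋃ i ∈ Finset.range k, f^[i] '' I) {n : ℕ} (hn : n < k)
    (hne : (C ∩ f^[n] '' I).Nonempty) : C ⊆ f^[n] '' I := by
  have hd : Disjoint (f^[n] '' I) (⋃ i ∈ {i | i < k ∧ i ≠ n}, f^[i] '' I) :=
    disjoint_iUnion₂_right.2 fun i hi => hI.2.2.2 n i hn hi.1 (Ne.symm hi.2)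
  have hcl : IsClosed (⋃ i ∈ {i | i < k ∧ i ≠ n}, f^[i] '' I) :=
    ((finite_lt_nat k).subset fun i hi => hi.1).isClosed_biUnion fun i _ =>
      hI.isClosed_image hG hf i
  obtain ⟨p, hpC, hpn⟩ := hne
  rcases isPreconnected_iff_subset_of_disjoint_closed.1 hC _ _ (hI.isClosed_image hG hf n) hcl
    (fun q hq => by
      obtain ⟨i, hi, hqi⟩ := mem_iUnion₂.1 (hsub hq)
      by_cases hin : i = n
      · exact Or.inl (hin ▸ hqi)
      · exact Or.inr (mem_biUnion (x := i) ⟨Finset.mem_range.1 hi, hin⟩ hqi))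
    (by rw [hd.inter_eq, inter_empty]) with h | h
  · exact h
  · exact (disjoint_left.1 hd hpn (h hpC)).elim

/-- A periodic subgraph of sufficiently large period meeting a given cycle of graphs is contained
in that cycle. -/
theorem IsPeriodicSubgraph.exists_forall_subset_orbit (hG : IsTopGraph G) (hf : Continuous f)
    (hI : IsPeriodicSubgraph f I k) : ∃ N : ℕ, ∀ K m, IsPeriodicSubgraph f K m → N ≤ m →
      (K ∩ ⋃ i ∈ Finset.range k, f^[i] '' I).Nonempty →
        K ⊆ ⋃ i ∈ Finset.range k, f^[i] '' I := by
  set S := ⋃ i ∈ Finset.range k, f^[i] '' I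
  have hScl : IsClosed S := hI.isClosed_orbit hG hf
  have hfin : (frontier S).Finite := by
    obtain ⟨n, ψ, h⟩ := hG.exists_isEdgeFamily
    refine Finite.subset (s := ⋃ i ∈ Finset.range k, frontier (f^[i] '' I)) ?_ fun p hp => ?_
    · exact (Finset.range k).finite_toSet.biUnion fun i _ =>
        h.finite_frontier (hI.isClosed_image hG hf i) (hI.isPreconnected_image hf i)
    · obtain ⟨i, hi, hpi⟩ := mem_iUnion₂.1 (hScl.frontier_subset hp)
      refine mem_iUnion₂.2 ⟨i, hi, subset_closure hpi, fun hint => hp.2 ?_⟩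
      exact interior_mono (subset_biUnion_of_mem (u := fun i => f^[i] '' I) hi) hint
  refine ⟨hfin.toFinset.card + 1, fun K m hK hm hne => ?_⟩
  obtain ⟨p, hpK, hpS⟩ := hne
  have : Nonempty G := ⟨p⟩
  obtain ⟨j, hjm, hj⟩ : ∃ j < m, Disjoint (f^[j] '' K) (frontier S) := by
    by_contra! hcon
    choose! q hq using fun j hj => not_disjoint_iff.1 (hcon j hj)
    have hcard := Finset.card_le_card_of_injOn (s := Finset.range m) (t := hfin.toFinset) q
      (fun j hj => by simpa using (hq j (by simpa using hj)).2) (fun i hi j hj hij => by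
        have hi' : i < m := by simpa using hi
        have hj' : j < m := by simpa using hj
        by_contra hne
        exact disjoint_left.1 (hK.2.2.2 i j hi' hj' hne) (hq i hi').1 (hij ▸ (hq j hj').1))
    rw [Finset.card_range] at hcard
    omega
  have hsub : f^[j] '' K ⊆ S :=
    (hK.isPreconnected_image hf j).subset_of_disjoint_frontier hScl
      ⟨f^[j] p, mem_image_of_mem _ hpK, hI.mapsTo_orbit j hpS⟩ hj
  rw [← hK.2.2.1, ← Nat.sub_add_cancel hjm.le, Function.iterate_add, image_comp]
  exact (image_mono hsub).trans (hI.mapsTo_orbit _).image_subset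

/-- A periodic subgraph of sufficiently large period meeting a given periodic subgraph is
contained in it. -/
theorem IsPeriodicSubgraph.exists_forall_subset (hG : IsTopGraph G) (hf : Continuous f)
    (hI : IsPeriodicSubgraph f I k) : ∃ N : ℕ, ∀ K m, IsPeriodicSubgraph f K m → N ≤ m →
      (K ∩ I).Nonempty → K ⊆ I := by
  obtain ⟨N, hN⟩ := hI.exists_forall_subset_orbit hG hf
  refine ⟨N, fun K m hK hm hne => ?_⟩
  simpa using hI.subset_image_of_subset_orbit hG hf hK.1.2.1.isPreconnected
    (hN K m hK hm (hne.mono (inter_subset_inter_right K hI.subset_orbit)))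
    hI.2.1 (by simpa using hne)

/-- Each point of a cycle of graphs lies in a component `K` of the cycle, which is separable from
every point of the cycle outside `K`. -/
theorem IsCycleOfGraphs.exists_component (hG : IsTopGraph G) (hf : Continuous f) {Z : Set G}
    (hZ : IsCycleOfGraphs f Z k) {x : G} (hx : x ∈ Z) :
    ∃ K, IsPeriodicSubgraph f K k ∧ x ∈ K ∧
      (∀ C ⊆ Z, IsPreconnected C → x ∈ C → C ⊆ K) ∧
      ∀ y ∈ Z, ¬ SeparablePoints f x y → y ∈ K := by
  obtain ⟨K, hK, rfl⟩ := hZ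
  obtain ⟨i, hi, hxi⟩ := mem_iUnion₂.1 hx
  have hi' := Finset.mem_range.1 hi
  refine ⟨f^[i] '' K, hK.image hG hf hi', hxi, fun C hCZ hC hxC =>
    hK.subset_image_of_subset_orbit hG hf hC hCZ hi' ⟨x, hxC, hxi⟩, fun y hy hns => ?_⟩
  obtain ⟨j, hj, hyj⟩ := mem_iUnion₂.1 hy
  have hj' := Finset.mem_range.1 hj
  by_cases hij : i = j
  · exact hij ▸ hyj
  · exact (hns ⟨_, _, k, k, hK.image hG hf hi', hK.image hG hf hj', hK.2.2.2 i j hi' hj' hij,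
      hxi, hyj⟩).elim

variable {W : Set G} {x y : G}

theorem IsSolenoid.exists_nested_of_not_separablePoints (hG : IsTopGraph G) (hf : Continuous f)
    (hW : IsSolenoid f W) (hx : x ∈ W) (hy : y ∈ W) (h : ¬ SeparablePoints f x y) :
    ∃ (J : ℕ → Set G) (m : ℕ → ℕ),
      (∀ n, IsPeriodicSubgraph f (J n) (m n)) ∧
      (∀ n, J (n + 1) ⊆ J n) ∧
      Tendsto m atTop atTop ∧
      ∀ n, x ∈ J n ∧ y ∈ J n := by
  have hlarge : ∀ n : ℕ, ∃ K k, n ≤ k ∧ IsPeriodicSubgraph f K k ∧ x ∈ K ∧ y ∈ K := by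
    intro n
    obtain ⟨Z, k, hnk, hZ, hWZ⟩ := hW.2 n
    obtain ⟨K, hK, hxK, -, hns⟩ := hZ.exists_component hG hf (hWZ hx)
    exact ⟨K, k, hnk, hK, hxK, hns y (hWZ hy) h⟩
  let T := {p : Set G × ℕ // IsPeriodicSubgraph f p.1 p.2 ∧ x ∈ p.1 ∧ y ∈ p.1}
  have hstep : ∀ p : T, ∃ q : T, q.1.1 ⊆ p.1.1 ∧ p.1.2 < q.1.2 := by
    rintro ⟨⟨I, k⟩, hI, hxI, hyI⟩
    obtain ⟨N, hN⟩ := hI.exists_forall_subset hG hf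
    obtain ⟨K, m, hm, hK, hxK, hyK⟩ := hlarge (max N (k + 1))
    exact ⟨⟨⟨K, m⟩, hK, hxK, hyK⟩,
      hN K m hK ((le_max_left _ _).trans hm) ⟨x, hxK, hxI⟩, (le_max_right _ _).trans hm⟩
  choose next hsub hlt using hstep
  obtain ⟨K, k, -, hK⟩ := hlarge 0
  let u : ℕ → T := fun n => next^[n] ⟨⟨K, k⟩, hK⟩
  have hu : ∀ n, u (n + 1) = next (u n) := fun n => Function.iterate_succ_apply' next n _
  refine ⟨fun n => (u n).1.1, fun n => (u n).1.2, fun n => (u n).2.1, fun n => ?_, ?_,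
    fun n => (u n).2.2⟩
  · change (u (n + 1)).1.1 ⊆ _
    rw [hu]
    exact hsub _
  · refine (strictMono_nat_of_lt_succ fun n => ?_).tendsto_atTop
    rw [hu]
    exact hlt _

theorem mem_connectedComponentIn_of_nested (hG : IsTopGraph G) (hf : Continuous f) (hx : x ∈ W)
    {J : ℕ → Set G} {m : ℕ → ℕ} (hJ : ∀ n, IsPeriodicSubgraph f (J n) (m n))
    (hanti : ∀ n, J (n + 1) ⊆ J n) (hm : Tendsto m atTop atTop)
    (hxy : ∀ n, x ∈ J n ∧ y ∈ J n) :
    y ∈ connectedComponentIn (⋂₀ {Z : Set G | ∃ k, IsCycleOfGraphs f Z k ∧ W ⊆ Z}) x := by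
  have := hG.1
  refine (isPreconnected_iInter_of_antitone (antitone_nat_of_succ_le hanti)
    (fun n => (hJ n).1.1.isCompact) fun n => (hJ n).1.2.1.isPreconnected).subset_connectedComponentIn
    (mem_iInter.2 fun n => (hxy n).1) ?_ (mem_iInter.2 fun n => (hxy n).2)
  rintro p hp Z ⟨k, ⟨I, hI, rfl⟩, hWZ⟩
  obtain ⟨N, hN⟩ := hI.exists_forall_subset_orbit hG hf
  obtain ⟨n, hn⟩ := (hm.eventually_ge_atTop N).exists
  exact hN _ _ (hJ n) hn ⟨x, (hxy n).1, hWZ hx⟩ (mem_iInter.1 hp n)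

theorem IsSolenoid.not_separablePoints_of_mem_connectedComponentIn (hG : IsTopGraph G)
    (hf : Continuous f) (hW : IsSolenoid f W) (hx : x ∈ W)
    (hy : y ∈ connectedComponentIn (⋂₀ {Z : Set G | ∃ k, IsCycleOfGraphs f Z k ∧ W ⊆ Z}) x) :
    ¬ SeparablePoints f x y := by
  rintro ⟨I, J, kI, kJ, hI, -, hd, hxI, hyJ⟩
  obtain ⟨N, hN⟩ := hI.exists_forall_subset hG hf
  obtain ⟨Z, k, hk, hZ, hWZ⟩ := hW.2 N
  obtain ⟨K, hK, hxK, hsub, -⟩ := hZ.exists_component hG hf (hWZ hx)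
  have hyK : y ∈ K := by
    refine hsub _ ?_ isPreconnected_connectedComponentIn (mem_connectedComponentIn ?_) hy
    · exact (connectedComponentIn_subset _ _).trans (sInter_subset_of_mem ⟨k, hZ, hWZ⟩)
    · exact fun Z' ⟨_, _, hWZ'⟩ => hWZ' hx
  exact disjoint_left.1 hd (hN K k hK hk ⟨x, hxK, hxI⟩ hyK) hyJ

end Periodic

/-- For distinct points `x, y` in a solenoid `ω_f(z)`: `x, y` are non-separable iff
they lie in a common nested sequence of periodic subgraphs with periods tending to
infinity, iff they lie in the same connected component of `P(z)`, where `P(z)` is the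
intersection of all cycles of graphs containing `ω_f(z)`. -/
theorem nonseparable_iff_nested_iff_component {G : Type*} [MetricSpace G]
    (hG : IsTopGraph G) (f : G → G) (hf : Continuous f) (z x y : G)
    (hsol : IsSolenoid f (omegaSet f z))
    (hx : x ∈ omegaSet f z) (hy : y ∈ omegaSet f z) (hxy : x ≠ y) :
    (¬ SeparablePoints f x y ↔
      ∃ (J : ℕ → Set G) (m : ℕ → ℕ),
        (∀ n, IsPeriodicSubgraph f (J n) (m n)) ∧
        (∀ n, J (n + 1) ⊆ J n) ∧
        Filter.Tendsto m Filter.atTop Filter.atTop ∧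
        ∀ n, x ∈ J n ∧ y ∈ J n) ∧
    (¬ SeparablePoints f x y ↔
      y ∈ connectedComponentIn
        (⋂₀ {Z : Set G | ∃ k, IsCycleOfGraphs f Z k ∧ omegaSet f z ⊆ Z}) x) := by
  have nested := hsol.exists_nested_of_not_separablePoints hG hf hx hy
  have nonsep := hsol.not_separablePoints_of_mem_connectedComponentIn (y := y) hG hf hx
  refine ⟨⟨nested, ?_⟩, ⟨fun h => ?_, nonsep⟩⟩
  · rintro ⟨J, m, hJ, hanti, hm, hmem⟩
    exact nonsep (mem_connectedComponentIn_of_nested hG hf hx hJ hanti hm hmem)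
  · obtain ⟨J, m, hJ, hanti, hm, hmem⟩ := nested h
    exact mem_connectedComponentIn_of_nested hG hf hx hJ hanti hm hmem
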